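/- Let (X,c_i,c_j) be a digital picture with {i,j} = {1,2} such that X is nonempty, c_i-connected, and has no hole. Then (X,c_i,c_j) is homotopy equivalent to (H_rc(X),c_i,c_j), where H_rc(X) is the rc-convex hull of X. -/

import Mathlib

/-- Points of the digital plane. -/
abbrev Pt : Type := ℤ × ℤ

/-- `c_i`-adjacency on `ℤ²` (for `i = 1` or `i = 2`). -/
def cAdj (i : ℕ) (x y : Pt) : Prop :=
  if i = 1 then |x.1 - y.1| + |x.2 - y.2| ≤ 1
  else |x.1 - y.1| ≤ 1 ∧ |x.2 - y.2| ≤ 1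

/-- The adjacency induced on a subset of `ℤ²`. -/
def subAdj (i : ℕ) (X : Set Pt) (x y : X) : Prop := cAdj i x.1 y.1

/-- Digital continuity of a map between digital images. -/
def DigCont {α β : Type} (κ : α → α → Prop) (δ : β → β → Prop) (f : α → β) : Prop :=
  ∀ x y, κ x y → δ (f x) (f y)

/-- The standard (`c_1`) adjacency on `ℕ`, used for digital intervals. -/
def natAdj (s t : ℕ) : Prop := s = t ∨ s + 1 = t ∨ t + 1 = s

/-- The two normal product adjacencies on `α × ℕ`. -/
def prodAdj (i : ℕ) {α : Type} (κ : α → α → Prop) (p q : α × ℕ) : Prop :=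
  if i = 1 then (κ p.1 q.1 ∧ p.2 = q.2) ∨ (p.1 = q.1 ∧ natAdj p.2 q.2)
  else κ p.1 q.1 ∧ natAdj p.2 q.2

/-- `f` and `g` are `i`-homotopic: there is a continuous
`H : X ×_i [0,m]_ℤ → Y` with `H(·,0) = f` and `H(·,m) = g`. -/
def Homotopic (i : ℕ) {α β : Type} (κ : α → α → Prop) (δ : β → β → Prop)
    (f g : α → β) : Prop :=
  ∃ (m : ℕ) (H : α → ℕ → β),
    (∀ x, H x 0 = f x) ∧ (∀ x, H x m = g x) ∧
    (∀ x y s t, s ≤ m → t ≤ m → prodAdj i κ (x, s) (y, t) → δ (H x s) (H y t))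

/-- `i`-homotopy equivalence of digital images. -/
def HtpyEquiv (i : ℕ) {α β : Type} (κ : α → α → Prop) (δ : β → β → Prop) : Prop :=
  ∃ (f : α → β) (g : β → α),
    DigCont κ δ f ∧ DigCont δ κ g ∧
    Homotopic i κ κ (g ∘ f) id ∧ Homotopic i δ δ (f ∘ g) id

/-- Homotopy equivalence of digital pictures `(X, c_i, c_j)` and `(Y, c_i, c_j)`. -/
def PicHtpyEquiv (i j : ℕ) (X Y : Set Pt) : Prop :=
  HtpyEquiv i (subAdj i X) (subAdj i Y) ∧ HtpyEquiv j (subAdj j Xᶜ) (subAdj j Yᶜ)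

/-- Isomorphism of digital images: a continuous bijection with continuous inverse. -/
def DigIso {α β : Type} (κ : α → α → Prop) (δ : β → β → Prop) : Prop :=
  ∃ e : α ≃ β, DigCont κ δ ⇑e ∧ DigCont δ κ ⇑e.symm

/-- Isomorphism of digital pictures. -/
def PicIso (i j : ℕ) (X Y : Set Pt) : Prop :=
  DigIso (subAdj i X) (subAdj i Y) ∧ DigIso (subAdj j Xᶜ) (subAdj j Yᶜ)

/-- `x` and `y` are joined by a `c_i`-path inside `A`. -/
def ChainIn (i : ℕ) (A : Set Pt) (x y : Pt) : Prop :=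
  ∃ (n : ℕ) (c : ℕ → Pt), c 0 = x ∧ c n = y ∧ (∀ k ≤ n, c k ∈ A) ∧
    ∀ k < n, cAdj i (c k) (c (k + 1))

/-- `A` is `c_i`-connected. -/
def Conn (i : ℕ) (A : Set Pt) : Prop := ∀ x ∈ A, ∀ y ∈ A, ChainIn i A x y

/-- The `c_i`-component of `p` in `A`. -/
def compOf (i : ℕ) (A : Set Pt) (p : Pt) : Set Pt := {y | ChainIn i A p y}

/-- The digital picture `(X, c_i, c_j)` has no hole: every `c_j`-component
of the complement of `X` is infinite. -/
def NoHole (j : ℕ) (X : Set Pt) : Prop := ∀ p ∈ Xᶜ, (compOf j Xᶜ p).Infinite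

/-- The row of `X` at height `k`. -/
def rowOf (X : Set Pt) (k : ℤ) : Set Pt := X ∩ {p | p.2 = k}

/-- `r` is a row component of `(X, c_i)`: a `c_i`-component of a row of `X`. -/
def IsRowComp (i : ℕ) (X : Set Pt) (r : Set Pt) : Prop :=
  ∃ (k : ℤ) (p : Pt), p ∈ rowOf X k ∧ r = compOf i (rowOf X k) p

/-- Two subsets of `ℤ²` are `c_i`-adjacent. -/
def setAdj (i : ℕ) (A B : Set Pt) : Prop := ∃ a ∈ A, ∃ b ∈ B, cAdj i a b

/-- The edge relation of the row component graph `R(X, c_i)`: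
two distinct row components joined when they are `c_i`-adjacent. -/
def rcgAdj (i : ℕ) (X : Set Pt) (r s : Set Pt) : Prop :=
  IsRowComp i X r ∧ IsRowComp i X s ∧ r ≠ s ∧ setAdj i r s

/-- The row component graph `R(X, c_i)` is acyclic: there is no cycle of
`k ≥ 3` distinct row components with consecutive ones adjacent. -/
def RCGAcyclic (i : ℕ) (X : Set Pt) : Prop :=
  ¬ ∃ (k : ℕ) (r : ℕ → Set Pt), 3 ≤ k ∧
    (∀ t < k, IsRowComp i X (r t)) ∧
    (∀ t < k, ∀ t' < k, r t = r t' → t = t') ∧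
    (∀ t, t + 1 < k → rcgAdj i X (r t) (r (t + 1))) ∧
    rcgAdj i X (r (k - 1)) (r 0)

/-- The row component graph `R(X, c_i)` is connected. -/
def RCGConnected (i : ℕ) (X : Set Pt) : Prop :=
  ∀ r s : Set Pt, IsRowComp i X r → IsRowComp i X s →
    Relation.ReflTransGen (rcgAdj i X) r s

/-- A digital image is `i`-contractible: the identity is `i`-homotopic to a constant map. -/
def Contractible (i : ℕ) {α : Type} (κ : α → α → Prop) : Prop :=
  ∃ x₀ : α, Homotopic i κ κ id (fun _ => x₀)

/-- Row-convexity. -/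
def RowConvex (X : Set Pt) : Prop :=
  ∀ a b c k : ℤ, (a, k) ∈ X → (c, k) ∈ X → a ≤ b → b ≤ c → (b, k) ∈ X

/-- Column-convexity. -/
def ColConvex (X : Set Pt) : Prop :=
  ∀ a b c k : ℤ, (k, a) ∈ X → (k, c) ∈ X → a ≤ b → b ≤ c → (k, b) ∈ X

/-- The row-convex hull of `X`. -/
def Hr (X : Set Pt) : Set Pt := ⋂₀ {S | RowConvex S ∧ X ⊆ S}

/-- The column-convex hull of `X`. -/
def Hc (X : Set Pt) : Set Pt := ⋂₀ {S | ColConvex S ∧ X ⊆ S}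

/-- The rc-convex hull of `X`. -/
def Hrc (X : Set Pt) : Set Pt := ⋂₀ {S | (RowConvex S ∧ ColConvex S) ∧ X ⊆ S}

/-- A loop of length `m` inside `Z`: a continuous `γ : [0,m]_ℤ → Z` with `γ 0 = γ m`. -/
def LoopIn (j : ℕ) (Z : Set Pt) (m : ℕ) (γ : ℕ → Pt) : Prop :=
  γ 0 = γ m ∧ (∀ t ≤ m, γ t ∈ Z) ∧ ∀ t < m, cAdj j (γ t) (γ (t + 1))

/-- The loop `γ` is `j`-contractible in `Z`: there is a `j`-homotopy in `Z` from `γ`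
to the constant loop at `γ 0` whose every stage is a loop based at `γ 0`. -/
def LoopContractibleIn (j : ℕ) (Z : Set Pt) (m : ℕ) (γ : ℕ → Pt) : Prop :=
  ∃ (K : ℕ) (H : ℕ → ℕ → Pt),
    (∀ t, H t 0 = γ t) ∧ (∀ t, H t K = γ 0) ∧
    (∀ k ≤ K, H 0 k = γ 0 ∧ H m k = γ 0) ∧
    (∀ t ≤ m, ∀ k ≤ K, H t k ∈ Z) ∧
    (∀ s t k l, s ≤ m → t ≤ m → k ≤ K → l ≤ K →
      prodAdj j natAdj (s, k) (t, l) → cAdj j (H s k) (H t l))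

/-- The union of the infinite `c_j`-components of the complement of `X`. -/
def InfPart (j : ℕ) (X : Set Pt) : Set Pt := {p | p ∈ Xᶜ ∧ (compOf j Xᶜ p).Infinite}

/-- The outer perimeter of the digital picture `(X, c_i, c_j)`: the least length of a
non-`j`-contractible loop in the infinite component of the complement of `X`, or `1`
if no such loop exists.  (It depends only on `j` and `X`.) -/
noncomputable def outerPerim (j : ℕ) (X : Set Pt) : ℕ := by
  classical
  exact if (∃ m γ, LoopIn j (InfPart j X) m γ ∧ ¬ LoopContractibleIn j (InfPart j X) m γ)
    then sInf {m | ∃ γ, LoopIn j (InfPart j X) m γ ∧ ¬ LoopContractibleIn j (InfPart j X) m γ}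
    else 1

/-- The digital rectangle `I_{n,m} = [1,n]_ℤ × [1,m]_ℤ`. -/
def Irect (n m : ℤ) : Set Pt := Set.Icc 1 n ×ˢ Set.Icc 1 m

/-- A finite digital image is `i`-reducible when it is `i`-homotopy equivalent to a
digital image with strictly fewer points. -/
def Reducible (i : ℕ) {α : Type} (κ : α → α → Prop) : Prop :=
  ∃ (β : Type) (δ : β → β → Prop), Reflexive δ ∧ Symmetric δ ∧ Finite β ∧
    Nat.card β < Nat.card α ∧ HtpyEquiv i κ δ

/-! ### Adjacency -/

theorem cAdj_one {x y : Pt} : cAdj 1 x y ↔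
    (x.2 = y.2 ∧ x.1 ≤ y.1 + 1 ∧ y.1 ≤ x.1 + 1) ∨
      (x.1 = y.1 ∧ x.2 ≤ y.2 + 1 ∧ y.2 ≤ x.2 + 1) := by
  simp only [cAdj, if_true]
  grind

theorem cAdj_two {x y : Pt} : cAdj 2 x y ↔
    x.1 ≤ y.1 + 1 ∧ y.1 ≤ x.1 + 1 ∧ x.2 ≤ y.2 + 1 ∧ y.2 ≤ x.2 + 1 := by
  simp only [cAdj]
  grind

theorem cAdj.le_two {i : ℕ} (hi : i = 1 ∨ i = 2) {x y : Pt} (h : cAdj i x y) :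
    x.1 ≤ y.1 + 1 ∧ y.1 ≤ x.1 + 1 ∧ x.2 ≤ y.2 + 1 ∧ y.2 ≤ x.2 + 1 := by
  rcases hi with rfl | rfl
  · rw [cAdj_one] at h; omega
  · exact cAdj_two.1 h

theorem cAdj_of_one {i : ℕ} (hi : i = 1 ∨ i = 2) {x y : Pt} (h : cAdj 1 x y) :
    cAdj i x y := by
  rcases hi with rfl | rfl
  · exact h
  · rw [cAdj_one] at h; rw [cAdj_two]; omega

theorem cAdj_refl {i : ℕ} (hi : i = 1 ∨ i = 2) (x : Pt) : cAdj i x x :=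
  cAdj_of_one hi (cAdj_one.2 (by omega))

theorem cAdj.symm {i : ℕ} (hi : i = 1 ∨ i = 2) {x y : Pt} (h : cAdj i x y) :
    cAdj i y x := by
  rcases hi with rfl | rfl
  · rw [cAdj_one] at h ⊢; omega
  · rw [cAdj_two] at h ⊢; omega

theorem cAdj.swap {i : ℕ} (hi : i = 1 ∨ i = 2) {x y : Pt} (h : cAdj i x y) :
    cAdj i x.swap y.swap := by
  rcases hi with rfl | rfl
  · rw [cAdj_one] at h ⊢; simp only [Prod.fst_swap, Prod.snd_swap]; omega
  · rw [cAdj_two] at h ⊢; simp only [Prod.fst_swap, Prod.snd_swap]; omega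

/-! ### Homotopies and homotopy equivalences -/

section Homotopy

variable {i : ℕ} {α β γ : Type} {κ : α → α → Prop} {δ : β → β → Prop} {ε : γ → γ → Prop}

theorem homotopic_refl (hδ : ∀ y, δ y y) {f : α → β} (hf : DigCont κ δ f) :
    Homotopic i κ δ f f := by
  refine ⟨0, fun x _ => f x, fun _ => rfl, fun _ => rfl, fun x y s t _ _ h => ?_⟩
  unfold prodAdj at h
  split_ifs at h
  · rcases h with h | h
    · exact hf _ _ h.1
    · obtain rfl : x = y := h.1
      exact hδ _
  · exact hf _ _ h.1

theorem Homotopic.postcomp {f g : α → β} (h : Homotopic i κ δ f g) {φ : β → γ}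
    (hφ : DigCont δ ε φ) : Homotopic i κ ε (φ ∘ f) (φ ∘ g) := by
  obtain ⟨m, H, h0, hm, hH⟩ := h
  exact ⟨m, fun x t => φ (H x t), fun x => congrArg φ (h0 x), fun x => congrArg φ (hm x),
    fun x y s t hs ht hxy => hφ _ _ (hH x y s t hs ht hxy)⟩

theorem Homotopic.precomp {f g : β → γ} (h : Homotopic i δ ε f g) {φ : α → β}
    (hφ : DigCont κ δ φ) : Homotopic i κ ε (f ∘ φ) (g ∘ φ) := by
  obtain ⟨m, H, h0, hm, hH⟩ := h
  refine ⟨m, fun x t => H (φ x) t, fun x => h0 _, fun x => hm _,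
    fun x y s t hs ht hxy => hH _ _ s t hs ht ?_⟩
  unfold prodAdj at hxy ⊢
  split_ifs at hxy ⊢ with hi
  · exact hxy.imp (fun h => ⟨hφ _ _ h.1, h.2⟩) fun h => ⟨congrArg φ h.1, h.2⟩
  · exact ⟨hφ _ _ hxy.1, hxy.2⟩

theorem Homotopic.trans {f g h : α → β} (hfg : Homotopic i κ δ f g)
    (hgh : Homotopic i κ δ g h) : Homotopic i κ δ f h := by
  obtain ⟨m, H, h0, hm, hH⟩ := hfg
  obtain ⟨n, K, k0, kn, hK⟩ := hgh
  have hlow : ∀ x t, t ≤ m → (if t ≤ m then H x t else K x (t - m)) = H x t :=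
    fun x t ht => if_pos ht
  have hhigh : ∀ x t, m ≤ t → (if t ≤ m then H x t else K x (t - m)) = K x (t - m) := by
    intro x t ht
    split_ifs with h'
    · obtain rfl : t = m := le_antisymm h' ht
      rw [hm, Nat.sub_self, k0]
    · rfl
  refine ⟨m + n, fun x t => if t ≤ m then H x t else K x (t - m), fun x => ?_, fun x => ?_,
    fun x y s t hs ht hxy => ?_⟩
  · beta_reduce
    rw [hlow _ _ (Nat.zero_le _), h0]
  · beta_reduce
    rw [hhigh _ _ (Nat.le_add_right _ _), Nat.add_sub_cancel_left, kn]
  · have hst : natAdj s t := by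
      unfold prodAdj at hxy
      split_ifs at hxy
      · rcases hxy with hxy | hxy
        · exact Or.inl hxy.2
        · exact hxy.2
      · exact hxy.2
    unfold natAdj at hst
    beta_reduce
    by_cases hle : s ≤ m ∧ t ≤ m
    · rw [hlow x s hle.1, hlow y t hle.2]
      exact hH x y s t hle.1 hle.2 hxy
    · have hge : m ≤ s ∧ m ≤ t := by omega
      rw [hhigh x s hge.1, hhigh y t hge.2]
      refine hK x y _ _ (by omega) (by omega) ?_
      unfold prodAdj natAdj at hxy ⊢
      split_ifs at hxy ⊢
      · refine hxy.imp (fun h => ⟨h.1, ?_⟩) fun h => ⟨h.1, ?_⟩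
        · have := h.2
          dsimp only at this ⊢
          omega
        · dsimp only
          omega
      · refine ⟨hxy.1, ?_⟩
        dsimp only
        omega

theorem HtpyEquiv.symm (h : HtpyEquiv i κ δ) : HtpyEquiv i δ κ := by
  obtain ⟨f, g, hf, hg, h1, h2⟩ := h
  exact ⟨g, f, hg, hf, h2, h1⟩

theorem HtpyEquiv.trans (h : HtpyEquiv i κ δ) (h' : HtpyEquiv i δ ε) : HtpyEquiv i κ ε := by
  obtain ⟨f, g, hf, hg, h1, h2⟩ := h
  obtain ⟨f', g', hf', hg', h1', h2'⟩ := h'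
  exact ⟨f' ∘ f, g ∘ g', fun x y hxy => hf' _ _ (hf _ _ hxy), fun x y hxy => hg _ _ (hg' _ _ hxy),
    ((h1'.precomp hf).postcomp hg).trans h1, ((h2.precomp hg').postcomp hf').trans h2'⟩

end Homotopy

theorem htpyEquiv_refl {i : ℕ} (hi : i = 1 ∨ i = 2) (A : Set Pt) :
    HtpyEquiv i (subAdj i A) (subAdj i A) := by
  have h : Homotopic i (subAdj i A) (subAdj i A) id id :=
    homotopic_refl (fun y => cAdj_refl hi y.1) fun _ _ h => h
  exact ⟨id, id, fun _ _ h => h, fun _ _ h => h, h, h⟩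

theorem htpyEquiv_swap {i : ℕ} (hi : i = 1 ∨ i = 2) (A : Set Pt) :
    HtpyEquiv i (subAdj i A) (subAdj i (Prod.swap ⁻¹' A)) :=
  ⟨fun p => ⟨p.1.swap, by simp⟩, fun p => ⟨p.1.swap, p.2⟩,
    fun _ _ h => cAdj.swap hi h, fun _ _ h => cAdj.swap hi h,
    homotopic_refl (f := id) (fun y => cAdj_refl hi y.1) fun _ _ h => h,
    homotopic_refl (f := id) (fun y => cAdj_refl hi y.1) fun _ _ h => h⟩

theorem htpyEquiv_singleton {i : ℕ} (hi : i = 1 ∨ i = 2) (p : Pt) :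
    HtpyEquiv i (subAdj i {p}) (fun _ _ : Unit => True) := by
  refine ⟨fun _ => (), fun _ => ⟨p, rfl⟩, fun _ _ _ => trivial, fun _ _ _ => cAdj_refl hi p, ?_,
    homotopic_refl (f := id) (fun _ => trivial) fun _ _ h => h⟩
  refine ⟨0, fun x _ => x, fun x => Subtype.ext x.2, fun _ => rfl, ?_⟩
  rintro ⟨x, rfl⟩ ⟨y, rfl⟩ s t _ _ _
  exact cAdj_refl hi _

/-- A retraction which is one homotopy step away from the identity is a homotopy equivalence. -/
theorem htpyEquiv_of_retract {i : ℕ} (hi : i = 1 ∨ i = 2) {A A' : Set Pt} (hA : A' ⊆ A)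
    (f : Pt → Pt) (hf : ∀ p ∈ A, f p ∈ A') (hid : ∀ p ∈ A', f p = p)
    (hcont : ∀ p ∈ A, ∀ q ∈ A, cAdj i p q → cAdj i (f p) (f q))
    (hone : ∀ p ∈ A, cAdj i (f p) p)
    (htwo : i = 2 → ∀ p ∈ A, ∀ q ∈ A, cAdj i p q → cAdj i (f p) q) :
    HtpyEquiv i (subAdj i A) (subAdj i A') := by
  refine ⟨fun p => ⟨f p, hf p p.2⟩, fun p => ⟨p, hA p.2⟩,
    fun p q h => hcont p p.2 q q.2 h, fun p q h => h, ?_, ?_⟩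
  · refine ⟨1, fun p t => if t = 0 then ⟨f p, hA (hf p p.2)⟩ else p, fun p => rfl, fun p => rfl,
      fun p q s t hs ht h => ?_⟩
    have key : (if i = 1 then (cAdj i p.1 q.1 ∧ s = t) ∨ p = q else cAdj i p.1 q.1) := by
      unfold prodAdj at h
      split_ifs at h ⊢
      · exact h.imp_right And.left
      · exact h.1
    change cAdj i _ _
    by_cases hs0 : s = 0 <;> by_cases ht0 : t = 0
    · simp only [hs0, ht0, if_true]
      split_ifs at key
      · rcases key with key | rfl
        · exact hcont _ p.2 _ q.2 key.1
        · exact cAdj_refl hi _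
      · exact hcont _ p.2 _ q.2 key
    · simp only [hs0, ht0, if_true, if_false]
      split_ifs at key
      · rcases key with key | rfl
        · exact absurd (key.2.symm.trans hs0) ht0
        · exact hone _ p.2
      · exact htwo (by omega) _ p.2 _ q.2 key
    · simp only [hs0, ht0, if_true, if_false]
      split_ifs at key
      · rcases key with key | rfl
        · exact absurd (key.2.trans ht0) hs0
        · exact (hone _ p.2).symm hi
      · exact (htwo (by omega) _ q.2 _ p.2 (key.symm hi)).symm hi
    · simp only [hs0, ht0, if_false]
      split_ifs at key
      · rcases key with key | rfl
        · exact key.1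
        · exact cAdj_refl hi _
      · exact key
  · refine ⟨0, fun p _ => p, fun p => Subtype.ext (hid p p.2).symm, fun p => rfl,
      fun p q s t hs ht h => ?_⟩
    unfold prodAdj at h
    split_ifs at h
    · rcases h with h | h
      · exact h.1
      · obtain rfl : p = q := h.1
        exact cAdj_refl hi _
    · exact h.1

/-! ### Connectedness -/

/-- `p` and `q` are joined by a `c_i`-path inside `A` (or are equal). -/
def Linked (i : ℕ) (A : Set Pt) : Pt → Pt → Prop :=
  Relation.ReflTransGen fun x y => x ∈ A ∧ y ∈ A ∧ cAdj i x y

/-- Any two points of `A` are `Linked` in `A`. -/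
def LinkConn (i : ℕ) (A : Set Pt) : Prop := ∀ p ∈ A, ∀ q ∈ A, Linked i A p q

theorem Linked.symm {i : ℕ} (hi : i = 1 ∨ i = 2) {A : Set Pt} {p q : Pt}
    (h : Linked i A p q) : Linked i A q p := by
  induction h with
  | refl => exact Relation.ReflTransGen.refl
  | tail _ h ih => exact Relation.ReflTransGen.head ⟨h.2.1, h.1, h.2.2.symm hi⟩ ih

theorem Linked.mono {i : ℕ} {A B : Set Pt} (hAB : A ⊆ B) {p q : Pt} (h : Linked i A p q) :
    Linked i B p q := by
  induction h with
  | refl => exact Relation.ReflTransGen.refl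
  | tail _ h ih => exact ih.tail ⟨hAB h.1, hAB h.2.1, h.2.2⟩

theorem LinkConn.of_root {i : ℕ} (hi : i = 1 ∨ i = 2) {A : Set Pt} {r : Pt}
    (h : ∀ p ∈ A, Linked i A r p) : LinkConn i A :=
  fun p hp q hq => ((h p hp).symm hi).trans (h q hq)

theorem LinkConn.swap {i : ℕ} (hi : i = 1 ∨ i = 2) {A : Set Pt} (h : LinkConn i A) :
    LinkConn i (Prod.swap ⁻¹' A) := by
  have key : ∀ p q, Linked i A p q → Linked i (Prod.swap ⁻¹' A) p.swap q.swap := by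
    intro p q hpq
    induction hpq with
    | refl => exact Relation.ReflTransGen.refl
    | tail _ h ih => exact ih.tail ⟨by simpa using h.1, by simpa using h.2.1, h.2.2.swap hi⟩
  exact fun p hp q hq => key _ _ (h _ hp _ hq)

theorem ChainIn.linked {i : ℕ} {A : Set Pt} {p q : Pt} (h : ChainIn i A p q) :
    Linked i A p q := by
  obtain ⟨n, c, rfl, rfl, hA, hc⟩ := h
  have : ∀ k ≤ n, Linked i A (c 0) (c k) := by
    intro k
    induction k with
    | zero => exact fun _ => Relation.ReflTransGen.refl
    | succ k ih =>
      exact fun hk => (ih (by omega)).tail ⟨hA k (by omega), hA _ hk, hc k (by omega)⟩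
  exact this n le_rfl

theorem linked_line {i : ℕ} {A : Set Pt} (c : ℤ → Pt) (hc : ∀ t, cAdj i (c t) (c (t + 1)))
    {m n : ℤ} (hmn : m ≤ n) (hA : ∀ t, m ≤ t → t ≤ n → c t ∈ A) : Linked i A (c m) (c n) := by
  induction n, hmn using Int.leInduction with
  | base => exact Relation.ReflTransGen.refl
  | succ n hmn ih =>
    exact (ih fun t h1 h2 => hA t h1 (by omega)).tail
      ⟨hA n hmn (by omega), hA _ (by omega) le_rfl, hc n⟩

theorem linked_horizontal {i : ℕ} (hi : i = 1 ∨ i = 2) {A : Set Pt} (x y k : ℤ)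
    (hA : ∀ t, min x y ≤ t → t ≤ max x y → (t, k) ∈ A) : Linked i A (x, k) (y, k) := by
  have hc : ∀ t : ℤ, cAdj i (t, k) (t + 1, k) := fun t =>
    cAdj_of_one hi (cAdj_one.2 (by simp; omega))
  rcases le_total x y with h | h
  · exact linked_line (fun t => (t, k)) hc h fun t h1 h2 => hA t (by omega) (by omega)
  · exact (linked_line (fun t => (t, k)) hc h fun t h1 h2 => hA t (by omega) (by omega)).symm hi

theorem linked_vertical {i : ℕ} (hi : i = 1 ∨ i = 2) {A : Set Pt} (x y k : ℤ)
    (hA : ∀ t, min x y ≤ t → t ≤ max x y → (k, t) ∈ A) : Linked i A (k, x) (k, y) := by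
  have hc : ∀ t : ℤ, cAdj i (k, t) (k, t + 1) := fun t =>
    cAdj_of_one hi (cAdj_one.2 (by simp; omega))
  rcases le_total x y with h | h
  · exact linked_line (fun t => (k, t)) hc h fun t h1 h2 => hA t (by omega) (by omega)
  · exact (linked_line (fun t => (k, t)) hc h fun t h1 h2 => hA t (by omega) (by omega)).symm hi

/-! ### Runs: bounded row components -/

/-- The horizontal segment `[a,b] × {k}`. -/
def seg (a b k : ℤ) : Set Pt := {p | p.2 = k ∧ a ≤ p.1 ∧ p.1 ≤ b}

theorem mem_seg {a b k : ℤ} {p : Pt} : p ∈ seg a b k ↔ p.2 = k ∧ a ≤ p.1 ∧ p.1 ≤ b := Iff.rfl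

theorem mk_mem_seg {a b k x : ℤ} : (x, k) ∈ seg a b k ↔ a ≤ x ∧ x ≤ b := by
  simp [mem_seg]

/-- `[a,b] × {k}` is a bounded row component of `A`. -/
structure IsRun (A : Set Pt) (a b k : ℤ) : Prop where
  le : a ≤ b
  subset : seg a b k ⊆ A
  left : (a - 1, k) ∉ A
  right : (b + 1, k) ∉ A

theorem IsRun.eq_of_mem {A : Set Pt} {a b k a' b' k' : ℤ} (h : IsRun A a b k)
    (h' : IsRun A a' b' k') {p : Pt} (hp : p ∈ seg a b k) (hp' : p ∈ seg a' b' k') :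
    a = a' ∧ b = b' ∧ k = k' := by
  rw [mem_seg] at hp hp'
  obtain rfl : k = k' := by omega
  have h1 : ¬ (a ≤ a' - 1) := fun hh => h'.left (h.subset (mk_mem_seg.2 (by omega)))
  have h2 : ¬ (a' ≤ a - 1) := fun hh => h.left (h'.subset (mk_mem_seg.2 (by omega)))
  have h3 : ¬ (b' + 1 ≤ b) := fun hh => h'.right (h.subset (mk_mem_seg.2 (by omega)))
  have h4 : ¬ (b + 1 ≤ b') := fun hh => h.right (h'.subset (mk_mem_seg.2 (by omega)))
  omega

theorem linked_seg {i : ℕ} (hi : i = 1 ∨ i = 2) {A : Set Pt} {a b k : ℤ} (h : seg a b k ⊆ A)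
    {p q : Pt} (hp : p ∈ seg a b k) (hq : q ∈ seg a b k) : Linked i A p q := by
  obtain ⟨x, _⟩ := p
  obtain ⟨y, _⟩ := q
  obtain ⟨rfl, hp⟩ := hp
  obtain ⟨h2, hq⟩ := hq
  dsimp only at *
  subst h2
  exact linked_horizontal hi _ _ _ fun t h1 h2 => h ⟨rfl, by dsimp only; omega, by dsimp only; omega⟩

theorem exists_isRun {A : Set Pt} {z : Pt} (hz : z ∈ A) {x₁ x₂ : ℤ} (h₁ : x₁ < z.1)
    (h₂ : z.1 < x₂) (hx₁ : (x₁, z.2) ∉ A) (hx₂ : (x₂, z.2) ∉ A) :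
    ∃ a b, IsRun A a b z.2 ∧ z ∈ seg a b z.2 ∧ x₁ < a ∧ b < x₂ := by
  obtain ⟨l, ⟨hl1, hl2⟩, hl⟩ := Int.exists_greatest_of_bdd (P := fun x => x < z.1 ∧ (x, z.2) ∉ A)
    ⟨z.1, fun x hx => hx.1.le⟩ ⟨x₁, h₁, hx₁⟩
  obtain ⟨r, ⟨hr1, hr2⟩, hr⟩ := Int.exists_least_of_bdd (P := fun x => z.1 < x ∧ (x, z.2) ∉ A)
    ⟨z.1, fun x hx => hx.1.le⟩ ⟨x₂, h₂, hx₂⟩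
  have hl' := hl x₁ ⟨h₁, hx₁⟩
  have hr' := hr x₂ ⟨h₂, hx₂⟩
  refine ⟨l + 1, r - 1, ⟨by omega, ?_, by simpa using hl2, by simpa using hr2⟩,
    ⟨rfl, by omega, by omega⟩, by omega, by omega⟩
  rintro ⟨x, y⟩ ⟨hy, hx⟩
  dsimp only at hx hy
  subst hy
  by_contra hn
  rcases lt_trichotomy x z.1 with h | rfl | h
  · have := hl x ⟨h, hn⟩
    omega
  · exact hn hz
  · have := hr x ⟨h, hn⟩
    omega

/-! ### Crossing parities -/

/-- A list of `c_i`-steps inside `A`. -/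
def StepsIn (i : ℕ) (A : Set Pt) (L : List (Pt × Pt)) : Prop :=
  ∀ e ∈ L, e.1 ∈ A ∧ e.2 ∈ A ∧ cAdj i e.1 e.2

theorem Linked.exists_steps {i : ℕ} {A : Set Pt} {p q : Pt} (h : Linked i A p q) :
    ∃ L, StepsIn i A L ∧
      ∀ f : Pt → ZMod 2, (L.map fun e => f e.1 + f e.2).sum = f p + f q := by
  induction h with
  | refl => exact ⟨[], by simp [StepsIn], fun f => by simp [CharTwo.add_self_eq_zero]⟩
  | @tail b c _ hbc ih =>
    obtain ⟨L, hL, hsum⟩ := ih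
    refine ⟨(b, c) :: L, ?_, fun f => ?_⟩
    · rintro e he
      rcases List.mem_cons.1 he with rfl | he
      · exact hbc
      · exact hL e he
    · rw [List.map_cons, List.sum_cons, hsum f]
      linear_combination CharTwo.add_self_eq_zero (f b)

/-- The indicator function of the open half row to the right of `q`. -/
def rightOf (q p : Pt) : ZMod 2 := if p.2 = q.2 ∧ q.1 < p.1 then 1 else 0

/-- The indicator function of the steps joining the open half row to the right of `q` to the
row `σ` units above. -/
def crossing (q : Pt) (σ : ℤ) (e : Pt × Pt) : ZMod 2 :=
  if (e.1.2 = q.2 ∧ e.2.2 = q.2 + σ ∧ q.1 < e.1.1) ∨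
    (e.2.2 = q.2 ∧ e.1.2 = q.2 + σ ∧ q.1 < e.2.1) then 1 else 0

/-- The number modulo `2` of steps of `L` joining the open half row to the right of `q` to the
row `σ` units above. -/
def crossings (q : Pt) (σ : ℤ) (L : List (Pt × Pt)) : ZMod 2 := (L.map (crossing q σ)).sum

theorem crossings_cons (q : Pt) (σ : ℤ) (e : Pt × Pt) (L : List (Pt × Pt)) :
    crossings q σ (e :: L) = crossing q σ e + crossings q σ L := by
  simp [crossings]

theorem crossings_congr {L : List (Pt × Pt)} {q q' : Pt} {σ σ' : ℤ}
    (h : ∀ e ∈ L, crossing q σ e = crossing q' σ' e) : crossings q σ L = crossings q' σ' L :=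
  congrArg List.sum (List.map_congr_left h)

theorem crossing_add_crossing {i : ℕ} (hi : i = 1 ∨ i = 2) {A : Set Pt} {e : Pt × Pt}
    (he : e.1 ∈ A ∧ e.2 ∈ A ∧ cAdj i e.1 e.2) {q : Pt} (hq : q ∉ A) :
    crossing q 1 e + crossing q (-1) e = rightOf q e.1 + rightOf q e.2 := by
  obtain ⟨⟨x, y⟩, ⟨x', y'⟩⟩ := e
  obtain ⟨u, v⟩ := q
  obtain ⟨h1, h2, h3⟩ := he
  have h4 : ¬ (x = u ∧ y = v) := by rintro ⟨rfl, rfl⟩; exact hq h1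
  have h5 : ¬ (x' = u ∧ y' = v) := by rintro ⟨rfl, rfl⟩; exact hq h2
  have h6 := h3.le_two hi
  have h7 : (1 : ZMod 2) + 1 = 0 := by decide
  simp only [crossing, rightOf] at *
  split_ifs <;> first | omega | simp [h7]

theorem crossing_eq_of_row {i : ℕ} {A : Set Pt} {e : Pt × Pt}
    (he : e.1 ∈ A ∧ e.2 ∈ A ∧ cAdj i e.1 e.2) {q q' : Pt} (hq : q ∉ A) (hq' : q' ∉ A)
    (hrow : q.2 = q'.2) (h : q.1 ≤ q'.1 + 1 ∧ q'.1 ≤ q.1 + 1) (σ : ℤ) :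
    crossing q σ e = crossing q' σ e := by
  obtain ⟨⟨x, y⟩, ⟨x', y'⟩⟩ := e
  obtain ⟨u, v⟩ := q
  obtain ⟨u', v'⟩ := q'
  obtain ⟨h1, h2, h3⟩ := he
  have h4 : ¬ (x = u ∧ y = v) := by rintro ⟨rfl, rfl⟩; exact hq h1
  have h5 : ¬ (x' = u ∧ y' = v) := by rintro ⟨rfl, rfl⟩; exact hq h2
  have h4' : ¬ (x = u' ∧ y = v') := by rintro ⟨rfl, rfl⟩; exact hq' h1
  have h5' : ¬ (x' = u' ∧ y' = v') := by rintro ⟨rfl, rfl⟩; exact hq' h2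
  simp only [crossing] at *
  split_ifs <;> first | omega | rfl

theorem crossing_eq_of_next_row {i j : ℕ} (hij : (i = 1 ∧ j = 2) ∨ (i = 2 ∧ j = 1)) {A : Set Pt}
    {e : Pt × Pt} (he : e.1 ∈ A ∧ e.2 ∈ A ∧ cAdj i e.1 e.2) {q q' : Pt} (hq : q ∉ A)
    (hq' : q' ∉ A) (hrow : q'.2 = q.2 + 1) (h : cAdj j q q') :
    crossing q 1 e = crossing q' (-1) e := by
  obtain ⟨⟨x, y⟩, ⟨x', y'⟩⟩ := e
  obtain ⟨u, v⟩ := q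
  obtain ⟨u', v'⟩ := q'
  obtain ⟨h1, h2, h3⟩ := he
  have h4 : ¬ (x = u ∧ y = v) := by rintro ⟨rfl, rfl⟩; exact hq h1
  have h5 : ¬ (x' = u ∧ y' = v) := by rintro ⟨rfl, rfl⟩; exact hq h2
  have h4' : ¬ (x = u' ∧ y = v') := by rintro ⟨rfl, rfl⟩; exact hq' h1
  have h5' : ¬ (x' = u' ∧ y' = v') := by rintro ⟨rfl, rfl⟩; exact hq' h2
  rcases hij with ⟨rfl, rfl⟩ | ⟨rfl, rfl⟩ <;> simp only [cAdj_one, cAdj_two, crossing] at * <;>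
    split_ifs <;> first | omega | rfl

/-- The crossing numbers of a closed curve in `A` are constant on the components of the
complement of `A`. -/
theorem crossings_eq {i j : ℕ} (hij : (i = 1 ∧ j = 2) ∨ (i = 2 ∧ j = 1)) {A : Set Pt}
    {L : List (Pt × Pt)} (hL : StepsIn i A L)
    (hclosed : ∀ q ∉ A, (L.map fun e => rightOf q e.1 + rightOf q e.2).sum = 0)
    {q q' : Pt} (hq : q ∉ A) (h : Linked j Aᶜ q q')
    {σ σ' : ℤ} (hσ : σ = 1 ∨ σ = -1) (hσ' : σ' = 1 ∨ σ' = -1) :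
    crossings q σ L = crossings q' σ' L := by
  have hi : i = 1 ∨ i = 2 := by omega
  have hj : j = 1 ∨ j = 2 := by omega
  have hflip : ∀ q ∉ A, crossings q 1 L = crossings q (-1) L := by
    intro q hq
    refine CharTwo.add_eq_zero.1 ?_
    rw [crossings, crossings, ← List.sum_map_add, ← hclosed q hq]
    exact congrArg List.sum
      (List.map_congr_left fun e he => crossing_add_crossing hi (hL e he) hq)
  have hsign : ∀ q ∉ A, ∀ σ : ℤ, σ = 1 ∨ σ = -1 → crossings q σ L = crossings q 1 L := by
    rintro q hq σ (rfl | rfl)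
    · rfl
    · exact (hflip q hq).symm
  have key : q' ∉ A ∧ crossings q 1 L = crossings q' 1 L := by
    induction h with
    | refl => exact ⟨hq, rfl⟩
    | @tail b c _ hbc ih =>
      obtain ⟨hb, hc, hadj⟩ := hbc
      refine ⟨hc, ih.2.trans ?_⟩
      have h2 := hadj.le_two hj
      obtain hrow | hrow | hrow : b.2 = c.2 ∨ c.2 = b.2 + 1 ∨ b.2 = c.2 + 1 := by omega
      · exact crossings_congr fun e he =>
          crossing_eq_of_row (hL e he) hb hc hrow ⟨h2.1, h2.2.1⟩ 1
      · exact (crossings_congr fun e he =>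
          crossing_eq_of_next_row hij (hL e he) hb hc hrow hadj).trans (hflip c hc).symm
      · exact (hflip b hb).trans (crossings_congr fun e he =>
          crossing_eq_of_next_row hij (hL e he) hc hb hrow (hadj.symm hj)).symm
  rw [hsign q hq σ hσ, hsign q' key.1 σ' hσ']
  exact key.2

/-- The closed curve obtained from a path outside a run by passing through the run. -/
theorem IsRun.exists_closed_steps {i : ℕ} {A : Set Pt} {a b k : ℤ}
    (hv : IsRun A a b k) {p p' y y' : Pt} (hp : p ∈ A \ seg a b k) (hp' : p' ∈ A \ seg a b k)
    (hlink : Linked i (A \ seg a b k) p p') (hy : y ∈ seg a b k) (hy' : y' ∈ seg a b k)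
    (hyp : cAdj i y p) (hyp' : cAdj i y' p') :
    ∃ L, StepsIn i (A \ seg a b k) L ∧ StepsIn i A ((y, p) :: (y', p') :: L) ∧
      ∀ q ∉ A, (((y, p) :: (y', p') :: L).map fun e => rightOf q e.1 + rightOf q e.2).sum = 0 := by
  obtain ⟨L, hL, hsum⟩ := hlink.exists_steps
  refine ⟨L, hL, ?_, fun q hq => ?_⟩
  · intro e he
    rcases List.mem_cons.1 he with rfl | he
    · exact ⟨hv.subset hy, hp.1, hyp⟩
    rcases List.mem_cons.1 he with rfl | he
    · exact ⟨hv.subset hy', hp'.1, hyp'⟩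
    · exact ⟨(hL e he).1.1, (hL e he).2.1.1, (hL e he).2.2⟩
  · have hyy : rightOf q y = rightOf q y' := by
      have hqv : ¬ (q.2 = k ∧ a ≤ q.1 ∧ q.1 ≤ b) := fun h => hq (hv.subset h)
      rw [mem_seg] at hy hy'
      simp only [rightOf]
      split_ifs <;> first | omega | rfl
    rw [List.map_cons, List.map_cons, List.sum_cons, List.sum_cons, hsum, hyy]
    linear_combination CharTwo.add_self_eq_zero (rightOf q y') +
      CharTwo.add_self_eq_zero (rightOf q p) + CharTwo.add_self_eq_zero (rightOf q p')

theorem IsRun.crossing_eq {i : ℕ} {A : Set Pt} {a b k : ℤ} (hv : IsRun A a b k) {e : Pt × Pt}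
    (he : e.1 ∈ A \ seg a b k ∧ e.2 ∈ A \ seg a b k ∧ cAdj i e.1 e.2) (σ : ℤ) :
    crossing (a - 1, k) σ e = crossing (b + 1, k) σ e := by
  obtain ⟨⟨x, y⟩, ⟨x', y'⟩⟩ := e
  obtain ⟨⟨h1, h1'⟩, ⟨h2, h2'⟩, -⟩ := he
  have h4 : ¬ (x = b + 1 ∧ y = k) := by rintro ⟨rfl, rfl⟩; exact hv.right h1
  have h5 : ¬ (x' = b + 1 ∧ y' = k) := by rintro ⟨rfl, rfl⟩; exact hv.right h2
  have := hv.le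
  simp only [crossing, mem_seg] at *
  split_ifs <;> first | omega | rfl

/-- Points on both sides of a run are not joined outside the run. -/
theorem IsRun.not_linked_of_opposite {i j : ℕ} (hij : (i = 1 ∧ j = 2) ∨ (i = 2 ∧ j = 1))
    {A : Set Pt} {a b k : ℤ} (hv : IsRun A a b k) (hconn : LinkConn j Aᶜ) {p p' y y' : Pt}
    (hp : p ∈ A \ seg a b k) (hp' : p' ∈ A \ seg a b k)
    (hy : y ∈ seg a b k) (hy' : y' ∈ seg a b k) (hyp : cAdj i y p) (hyp' : cAdj i y' p')
    (hrow : p.2 = k + 1) (hrow' : p'.2 = k - 1) : ¬ Linked i (A \ seg a b k) p p' := by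
  intro hlink
  obtain ⟨L, hL, hL', hclosed⟩ :=
    hv.exists_closed_steps hp hp' hlink hy hy' hyp hyp'
  have h := crossings_eq hij hL' hclosed hv.left (hconn _ hv.left _ hv.right)
    (σ := 1) (σ' := 1) (Or.inl rfl) (Or.inl rfl)
  rw [mem_seg] at hy hy'
  have e1 : crossing (a - 1, k) 1 (y, p) = 1 := if_pos (by dsimp only; omega)
  have e2 : crossing (b + 1, k) 1 (y, p) = 0 := if_neg (by dsimp only; omega)
  have e3 : crossing (a - 1, k) 1 (y', p') = 0 := if_neg (by dsimp only; omega)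
  have e4 : crossing (b + 1, k) 1 (y', p') = 0 := if_neg (by dsimp only; omega)
  have e5 : crossings (a - 1, k) 1 L = crossings (b + 1, k) 1 L :=
    crossings_congr fun e he => hv.crossing_eq (hL e he) 1
  simp only [crossings_cons, e1, e2, e3, e4, e5, zero_add, add_eq_right] at h
  exact one_ne_zero h

/-- Points on the same side of a run lying in different row components are not joined
outside the run. -/
theorem IsRun.not_linked_of_between {i j : ℕ} (hij : (i = 1 ∧ j = 2) ∨ (i = 2 ∧ j = 1))
    {A : Set Pt} {a b k : ℤ} (hv : IsRun A a b k) (hconn : LinkConn j Aᶜ) {p p' y y' : Pt}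
    (hp : p ∈ A \ seg a b k) (hp' : p' ∈ A \ seg a b k)
    (hy : y ∈ seg a b k) (hy' : y' ∈ seg a b k) (hyp : cAdj i y p) (hyp' : cAdj i y' p')
    {σ : ℤ} (hσ : σ = 1 ∨ σ = -1) (hrow : p.2 = k + σ) (hrow' : p'.2 = k + σ)
    {x : ℤ} (hx : (x, k + σ) ∉ A) (hpx : p.1 < x) (hxp : x < p'.1) :
    ¬ Linked i (A \ seg a b k) p p' := by
  intro hlink
  have hi : i = 1 ∨ i = 2 := by omega
  obtain ⟨L, hL, hL', hclosed⟩ := hv.exists_closed_steps hp hp' hlink hy hy' hyp hyp'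
  have h := crossings_eq hij hL' hclosed hv.left (hconn _ hv.left _ hx)
    (σ := σ) (σ' := -σ) hσ (by omega)
  have h2 := hyp.le_two hi
  have h2' := hyp'.le_two hi
  rw [mem_seg] at hy hy'
  have e1 : crossing (a - 1, k) σ (y, p) = 1 := if_pos (by dsimp only; omega)
  have e2 : crossing (x, k + σ) (-σ) (y, p) = 0 := if_neg (by dsimp only; omega)
  have e3 : crossing (a - 1, k) σ (y', p') = 1 := if_pos (by dsimp only; omega)
  have e4 : crossing (x, k + σ) (-σ) (y', p') = 1 := if_pos (by dsimp only; omega)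
  have e5 : crossings (a - 1, k) σ L = crossings (x, k + σ) (-σ) L := by
    refine crossings_congr fun e he => ?_
    obtain ⟨⟨x₁, y₁⟩, ⟨x₂, y₂⟩⟩ := e
    obtain ⟨⟨h1, h1'⟩, ⟨h2, h2'⟩, h3⟩ := hL _ he
    have h4 : ¬ (x₁ = b + 1 ∧ y₁ = k) := by rintro ⟨rfl, rfl⟩; exact hv.right h1
    have h5 : ¬ (x₂ = b + 1 ∧ y₂ = k) := by rintro ⟨rfl, rfl⟩; exact hv.right h2
    have h6 := h3.le_two hi
    have h7 : ¬ (x₁ = x ∧ y₁ = k + σ) := by rintro ⟨rfl, rfl⟩; exact hx h1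
    have h8 : ¬ (x₂ = x ∧ y₂ = k + σ) := by rintro ⟨rfl, rfl⟩; exact hx h2
    simp only [crossing, mem_seg] at *
    split_ifs <;> first | omega | rfl
  simp only [crossings_cons, e1, e2, e3, e4, e5, zero_add, add_eq_right] at h
  exact one_ne_zero h

/-! ### Pushing a run into its only neighbour -/

open Classical in
theorem htpyEquiv_diff_singleton {i : ℕ} (hi : i = 1 ∨ i = 2) {A : Set Pt} {p q : Pt}
    (hq : q ∈ A) (hqp : q ≠ p) (hadj : cAdj i q p)
    (hN : ∀ r ∈ A, cAdj i p r → r ≠ p → cAdj i q r) :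
    HtpyEquiv i (subAdj i A) (subAdj i (A \ {p})) := by
  have hN' : ∀ r ∈ A, cAdj i p r → cAdj i q r := fun r hr h => by
    by_cases hrp : r = p
    · rwa [hrp]
    · exact hN r hr h hrp
  refine htpyEquiv_of_retract hi Set.sdiff_subset (fun r => if r = p then q else r) ?_ ?_ ?_ ?_ ?_
  · intro r hr
    split_ifs with h
    · exact ⟨hq, hqp⟩
    · exact ⟨hr, h⟩
  · exact fun r hr => if_neg hr.2
  · intro r hr s hs h
    split_ifs with h1 h2 h2
    · exact cAdj_refl hi q
    · exact hN' s hs (h1 ▸ h)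
    · exact (hN' r hr (h2 ▸ h.symm hi)).symm hi
    · exact h
  · intro r hr
    split_ifs with h1
    · rwa [h1]
    · exact cAdj_refl hi r
  · intro _ r hr s hs h
    split_ifs with h1
    · exact hN' s hs (h1 ▸ h)
    · exact h

open Classical in
theorem htpyEquiv_diff_seg_of_covered {i : ℕ} (hi : i = 1 ∨ i = 2) {σ : ℤ} (hσ : σ = 1 ∨ σ = -1)
    {A : Set Pt} {a b c d k : ℤ} (hcd : c ≤ d) (hS : seg c d (k + σ) ⊆ A)
    (hac : a - 1 ≤ c) (hdb : d ≤ b + 1) (h1 : i = 1 → a ≤ c ∧ d ≤ b)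
    (hN : ∀ y ∈ seg a b k, ∀ p ∈ A, cAdj i y p → p ∈ seg a b k ∨ p ∈ seg c d (k + σ))
    (hcov : a = b ∨ (c ≤ a ∧ b ≤ d)) :
    HtpyEquiv i (subAdj i A) (subAdj i (A \ seg a b k)) := by
  obtain ⟨g, hg⟩ : ∃ g : Pt → Pt, ∀ p, g p = (max c (min p.1 d), k + σ) := ⟨_, fun _ => rfl⟩
  have h1' : i = 2 ∨ (a ≤ c ∧ d ≤ b) := hi.symm.imp_right h1
  clear h1
  have hout : ∀ p ∈ seg a b k, ∀ q ∈ seg c d (k + σ), cAdj i p q → cAdj i (g p) q := by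
    rintro ⟨x, y⟩ hp ⟨x', y'⟩ hq hadj
    rcases hi with rfl | rfl <;> simp only [cAdj_one, cAdj_two, mem_seg, hg] at * <;> omega
  have hin : ∀ p ∈ seg a b k, ∀ q ∈ seg a b k, cAdj i p q → cAdj i (g p) (g q) := by
    rintro ⟨x, y⟩ - ⟨x', y'⟩ - hadj
    have h := hadj.le_two hi
    refine cAdj_of_one hi (cAdj_one.2 ?_)
    rw [hg, hg]
    clear hN hS hout hg
    dsimp only at *
    omega
  have hself : ∀ p ∈ seg a b k, cAdj i (g p) p := by
    rintro ⟨x, y⟩ hp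
    rcases hi with rfl | rfl <;> simp only [cAdj_one, cAdj_two, mem_seg, hg] at * <;> omega
  have hstrong : i = 2 → ∀ p ∈ seg a b k, ∀ q ∈ seg a b k, cAdj i p q → cAdj i (g p) q := by
    rintro rfl ⟨x, y⟩ hp ⟨x', y'⟩ hq hadj
    simp only [cAdj_two, mem_seg, hg] at *
    omega
  have hg' : ∀ p, g p ∈ A \ seg a b k := by
    intro p
    rw [hg]
    refine ⟨hS (mk_mem_seg.2 (by omega)), fun h => ?_⟩
    rw [mem_seg] at h
    dsimp only at h
    omega
  refine htpyEquiv_of_retract hi Set.sdiff_subset (fun p => if p ∈ seg a b k then g p else p)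
    ?_ ?_ ?_ ?_ ?_
  · intro p hp
    split_ifs with h
    · exact hg' p
    · exact ⟨hp, h⟩
  · exact fun p hp => if_neg hp.2
  · intro p hp q hq h
    split_ifs with h1 h2 h2
    · exact hin p h1 q h2 h
    · exact hout p h1 q ((hN p h1 q hq h).resolve_left h2) h
    · exact (hout q h2 p ((hN q h2 p hp (h.symm hi)).resolve_left h1) (h.symm hi)).symm hi
    · exact h
  · intro p hp
    split_ifs with h1
    · exact hself p h1
    · exact cAdj_refl hi p
  · intro hi2 p hp q hq h
    split_ifs with h1
    · rcases hN p h1 q hq h with h2 | h2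
      · exact hstrong hi2 p h1 q h2 h
      · exact hout p h1 q h2 h
    · exact h

theorem htpyEquiv_diff_seg {i : ℕ} (hi : i = 1 ∨ i = 2) {σ : ℤ} (hσ : σ = 1 ∨ σ = -1)
    {k c d : ℤ} (hcd : c ≤ d) (n : ℕ) : ∀ {A : Set Pt} {a b : ℤ}, b - a = n →
    seg a b k ⊆ A → seg c d (k + σ) ⊆ A → a - 1 ≤ c → d ≤ b + 1 → (i = 1 → a ≤ c ∧ d ≤ b) →
    (∀ y ∈ seg a b k, ∀ p ∈ A, cAdj i y p → p ∈ seg a b k ∨ p ∈ seg c d (k + σ)) →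
    HtpyEquiv i (subAdj i A) (subAdj i (A \ seg a b k)) := by
  induction n with
  | zero =>
    intro A a b hab hA hS hac hdb h1 hN
    exact htpyEquiv_diff_seg_of_covered hi hσ hcd hS hac hdb h1 hN (Or.inl (by omega))
  | succ n ih =>
    intro A a b hab hA hS hac hdb h1 hN
    by_cases hca : c ≤ a
    · by_cases hbd : b ≤ d
      · exact htpyEquiv_diff_seg_of_covered hi hσ hcd hS hac hdb h1 hN (Or.inr ⟨hca, hbd⟩)
      · have hset : A \ seg a b k = (A \ {(b, k)}) \ seg a (b - 1) k := by
          ext ⟨x, y⟩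
          simp only [Set.mem_sdiff, Set.mem_singleton_iff, Prod.mk.injEq, mem_seg]
          by_cases hx : (x, y) ∈ A <;> simp only [hx, true_and, false_and]
          omega
        rw [hset]
        refine (htpyEquiv_diff_singleton hi (p := (b, k)) (q := (b - 1, k))
          (hA (mk_mem_seg.2 (by omega))) ?_ ?_ ?_).trans (ih (by omega) ?_ ?_ hac (by omega) ?_ ?_)
        · simp
        · exact cAdj_of_one hi (cAdj_one.2 (by dsimp only; omega))
        · rintro ⟨x, y⟩ hr h hne
          have := hN _ (mk_mem_seg.2 (by omega)) _ hr h
          rw [Ne, Prod.mk.injEq] at hne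
          rcases hi with rfl | rfl <;> simp only [cAdj_one, cAdj_two, mem_seg] at * <;> omega
        · rintro ⟨x, y⟩ hp
          rw [mem_seg] at hp
          refine ⟨hA (by rw [mem_seg]; dsimp only at *; omega), ?_⟩
          rw [Set.mem_singleton_iff, Prod.mk.injEq]
          dsimp only at *
          omega
        · rintro ⟨x, y⟩ hp
          refine ⟨hS hp, ?_⟩
          rw [mem_seg] at hp
          rw [Set.mem_singleton_iff, Prod.mk.injEq]
          dsimp only at *
          omega
        · intro hi1
          have := h1 hi1
          omega
        · rintro ⟨x, y⟩ hy ⟨x', y'⟩ ⟨hp, hpb⟩ h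
          rw [mem_seg] at hy
          have := hN (x, y) (by rw [mem_seg]; dsimp only at *; omega) _ hp h
          rw [Set.mem_singleton_iff, Prod.mk.injEq] at hpb
          simp only [mem_seg] at *
          omega
    · have hset : A \ seg a b k = (A \ {(a, k)}) \ seg (a + 1) b k := by
        ext ⟨x, y⟩
        simp only [Set.mem_sdiff, Set.mem_singleton_iff, Prod.mk.injEq, mem_seg]
        by_cases hx : (x, y) ∈ A <;> simp only [hx, true_and, false_and]
        omega
      rw [hset]
      refine (htpyEquiv_diff_singleton hi (p := (a, k)) (q := (a + 1, k))
        (hA (mk_mem_seg.2 (by omega))) ?_ ?_ ?_).trans (ih (by omega) ?_ ?_ (by omega) hdb ?_ ?_)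
      · simp
      · exact cAdj_of_one hi (cAdj_one.2 (by dsimp only; omega))
      · rintro ⟨x, y⟩ hr h hne
        have := hN _ (mk_mem_seg.2 (by omega)) _ hr h
        rw [Ne, Prod.mk.injEq] at hne
        rcases hi with rfl | rfl <;> simp only [cAdj_one, cAdj_two, mem_seg] at * <;> omega
      · rintro ⟨x, y⟩ hp
        rw [mem_seg] at hp
        refine ⟨hA (by rw [mem_seg]; dsimp only at *; omega), ?_⟩
        rw [Set.mem_singleton_iff, Prod.mk.injEq]
        dsimp only at *
        omega
      · rintro ⟨x, y⟩ hp
        refine ⟨hS hp, ?_⟩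
        rw [mem_seg] at hp
        rw [Set.mem_singleton_iff, Prod.mk.injEq]
        dsimp only at *
        omega
      · intro hi1
        have := h1 hi1
        omega
      · rintro ⟨x, y⟩ hy ⟨x', y'⟩ ⟨hp, hpb⟩ h
        rw [mem_seg] at hy
        have := hN (x, y) (by rw [mem_seg]; dsimp only at *; omega) _ hp h
        rw [Set.mem_singleton_iff, Prod.mk.injEq] at hpb
        simp only [mem_seg] at *
        omega

/-! ### Existence of a removable run -/

/-- The points of `A` outside the run `[a,b] × {k}` which the run separates from `r`. -/
def separated (i : ℕ) (A : Set Pt) (r : Pt) (a b k : ℤ) : Set Pt :=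
  {z | z ∈ A \ seg a b k ∧ ¬ Linked i (A \ seg a b k) r z}

/-- The points of the bounded runs of `A` avoiding `r`. -/
def runPoints (A : Set Pt) (r : Pt) : Set Pt :=
  {z | ∃ a b k, IsRun A a b k ∧ r ∉ seg a b k ∧ z ∈ seg a b k}

theorem exists_step_into {i : ℕ} {A S : Set Pt} {r s : Pt} (h : Linked i A r s) (hr : r ∉ S)
    (hs : s ∈ S) : ∃ p ∈ A \ S, ∃ y ∈ S, y ∈ A ∧ cAdj i p y ∧ Linked i (A \ S) r p := by
  have : (s ∉ S ∧ Linked i (A \ S) r s) ∨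
      ∃ p ∈ A \ S, ∃ y ∈ S, y ∈ A ∧ cAdj i p y ∧ Linked i (A \ S) r p := by
    clear hs
    induction h with
    | refl => exact Or.inl ⟨hr, Relation.ReflTransGen.refl⟩
    | @tail b c _ hbc ih =>
      rcases ih with ⟨hb, hrb⟩ | ih
      · by_cases hc : c ∈ S
        · exact Or.inr ⟨b, ⟨hbc.1, hb⟩, c, hc, hbc.2.1, hbc.2.2, hrb⟩
        · exact Or.inl ⟨hc, hrb.tail ⟨⟨hbc.1, hb⟩, ⟨hbc.2.1, hc⟩, hbc.2.2⟩⟩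
      · exact Or.inr ih
  exact this.resolve_left fun h => h.1 hs

theorem Linked.avoid {i : ℕ} {A S S' : Set Pt} {r p : Pt} (h : Linked i (A \ S) r p)
    (hS' : ∀ z ∈ S', ¬ Linked i (A \ S) r z) : Linked i (A \ S') r p := by
  induction h with
  | refl => exact Relation.ReflTransGen.refl
  | @tail b c hrb hbc ih =>
    exact ih.tail ⟨⟨hbc.1.1, fun h => hS' b h hrb⟩,
      ⟨hbc.2.1.1, fun h => hS' c h (hrb.tail hbc)⟩, hbc.2.2⟩

theorem exists_run_separated_eq_empty {i : ℕ} (hi : i = 1 ∨ i = 2) {A : Set Pt} {r : Pt}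
    (hr : r ∈ A) (hconn : LinkConn i A) (hfin : (runPoints A r).Finite)
    (hsep : ∀ a b k, IsRun A a b k → r ∉ seg a b k → separated i A r a b k ⊆ runPoints A r)
    (n : ℕ) : ∀ a b k, IsRun A a b k → r ∉ seg a b k → (separated i A r a b k).ncard = n →
      ∃ a b k, IsRun A a b k ∧ r ∉ seg a b k ∧ separated i A r a b k = ∅ := by
  induction n using Nat.strong_induction_on with
  | _ n ih =>
    rintro a b k hv hrv rfl
    rcases (separated i A r a b k).eq_empty_or_nonempty with h0 | ⟨z, hz⟩
    · exact ⟨a, b, k, hv, hrv, h0⟩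
    obtain ⟨a', b', k', hv', hrv', hzv'⟩ := hsep a b k hv hrv hz
    have hdisj : ∀ w ∈ seg a b k, w ∉ seg a' b' k' := by
      intro w hw hw'
      obtain ⟨rfl, rfl, rfl⟩ := hv.eq_of_mem hv' hw hw'
      exact hz.1.2 hzv'
    have hsub : seg a' b' k' ⊆ A \ seg a b k := fun w hw =>
      ⟨hv'.subset hw, fun h => hdisj w h hw⟩
    have hunr : ∀ w ∈ seg a' b' k', ¬ Linked i (A \ seg a b k) r w :=
      fun w hw h => hz.2 (h.trans (linked_seg hi hsub hw hzv'))
    have hlt : (separated i A r a' b' k').ncard < (separated i A r a b k).ncard := by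
      refine Set.ncard_lt_ncard (Set.ssubset_iff_exists.2 ⟨?_, z, hz, fun h => h.1.2 hzv'⟩)
        (hfin.subset (hsep a b k hv hrv))
      rintro y ⟨hy, hyr⟩
      by_contra hny
      refine hyr ?_
      by_cases hyv : y ∈ seg a b k
      · obtain ⟨p, hp, e, he, -, hadj, hrp⟩ :=
          exists_step_into (hconn r hr y hy.1) hrv hyv
        have h1 : Linked i (A \ seg a' b' k') r e :=
          (hrp.avoid hunr).tail ⟨⟨hp.1, fun h => hunr p h hrp⟩, ⟨hv.subset he, hdisj e he⟩, hadj⟩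
        have hsub' : seg a b k ⊆ A \ seg a' b' k' := fun w hw => ⟨hv.subset hw, hdisj w hw⟩
        exact h1.trans (linked_seg hi hsub' he hyv)
      · refine Linked.avoid ?_ hunr
        by_contra hl
        exact hny ⟨⟨hy.1, hyv⟩, hl⟩
    exact ih _ hlt a' b' k' hv' hrv' rfl

theorem IsRun.htpyEquiv_diff {i j : ℕ} (hij : (i = 1 ∧ j = 2) ∨ (i = 2 ∧ j = 1)) {A : Set Pt}
    {a b k : ℤ} (hv : IsRun A a b k) {r : Pt} (hrA : r ∈ A) (hrv : r ∉ seg a b k)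
    (hconn : LinkConn i A) (hconn' : LinkConn j Aᶜ) (hdiff : LinkConn i (A \ seg a b k)) :
    HtpyEquiv i (subAdj i A) (subAdj i (A \ seg a b k)) := by
  have hi : i = 1 ∨ i = 2 := by omega
  have hab := hv.le
  have hak : (a, k) ∈ seg a b k := mk_mem_seg.2 ⟨le_rfl, hab⟩
  obtain ⟨p₀, hp₀, y₀, hy₀, -, hadj₀, -⟩ :=
    exists_step_into (hconn r hrA _ (hv.subset hak)) hrv hak
  have hrow : ∀ p ∈ A \ seg a b k, ∀ y ∈ seg a b k, cAdj i y p →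
      p.2 = k + 1 ∨ p.2 = k + (-1) := by
    rintro ⟨x, y⟩ ⟨hp, hpv⟩ q hq h
    have h1 : ¬ (x = b + 1 ∧ y = k) := by rintro ⟨rfl, rfl⟩; exact hv.right hp
    have h2 : ¬ (x = a - 1 ∧ y = k) := by rintro ⟨rfl, rfl⟩; exact hv.left hp
    have h3 := h.le_two hi
    simp only [mem_seg] at *
    omega
  obtain ⟨σ, hσ, hσ₀⟩ : ∃ σ : ℤ, (σ = 1 ∨ σ = -1) ∧ p₀.2 = k + σ := by
    rcases hrow p₀ hp₀ y₀ hy₀ (hadj₀.symm hi) with h | h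
    · exact ⟨1, Or.inl rfl, h⟩
    · exact ⟨-1, Or.inr rfl, h⟩
  have hside : ∀ p ∈ A \ seg a b k, ∀ y ∈ seg a b k, cAdj i y p → p.2 = k + σ := by
    intro p hp y hy h
    by_contra hne
    have h1 := hrow p hp y hy h
    rcases hσ with rfl | rfl
    · exact hv.not_linked_of_opposite hij hconn' hp₀ hp hy₀ hy (hadj₀.symm hi) h hσ₀
        (by omega) (hdiff _ hp₀ _ hp)
    · exact hv.not_linked_of_opposite hij hconn' hp hp₀ hy hy₀ h (hadj₀.symm hi) (by omega)
        (by omega) (hdiff _ hp _ hp₀)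
  set P : ℤ → Prop := fun x => (x, k + σ) ∈ A ∧ ∃ y ∈ seg a b k, cAdj i y (x, k + σ) with hP
  have hP₀ : P p₀.1 := by
    have : p₀ = (p₀.1, k + σ) := Prod.ext rfl hσ₀
    exact ⟨this ▸ hp₀.1, y₀, hy₀, this ▸ hadj₀.symm hi⟩
  have hout : ∀ x, (x, k + σ) ∉ seg a b k := by
    intro x
    rw [mem_seg]
    dsimp only
    omega
  have hbd : ∀ x, P x → a - 1 ≤ x ∧ x ≤ b + 1 ∧ (i = 1 → a ≤ x ∧ x ≤ b) := by
    rintro x ⟨-, y, hy, h⟩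
    rw [mem_seg] at hy
    rcases hi with rfl | rfl <;> simp only [cAdj_one, cAdj_two] at h <;> omega
  obtain ⟨c, hc, hcmin⟩ := Int.exists_least_of_bdd (P := P) ⟨a - 1, fun x hx => (hbd x hx).1⟩
    ⟨_, hP₀⟩
  obtain ⟨d, hd, hdmax⟩ := Int.exists_greatest_of_bdd (P := P)
    ⟨b + 1, fun x hx => (hbd x hx).2.1⟩ ⟨_, hP₀⟩
  have hcd : c ≤ d := hcmin d hd
  refine htpyEquiv_diff_seg hi hσ hcd (b - a).toNat (by omega) hv.subset ?_ (hbd c hc).1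
    (hbd d hd).2.1 (fun h => ⟨((hbd c hc).2.2 h).1, ((hbd d hd).2.2 h).2⟩) ?_
  · rintro ⟨x, y⟩ ⟨hy, hcx, hxd⟩
    dsimp only at hy hcx hxd
    subst hy
    by_contra hx
    have hxc : x ≠ c := by rintro rfl; exact hx hc.1
    have hxd' : x ≠ d := by rintro rfl; exact hx hd.1
    obtain ⟨hcA, y, hy, hyc⟩ := hc
    obtain ⟨hdA, y', hy', hyd⟩ := hd
    exact hv.not_linked_of_between hij hconn' ⟨hcA, hout c⟩ ⟨hdA, hout d⟩ hy hy' hyc hyd hσ rfl rfl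
      hx (by dsimp only; omega) (by dsimp only; omega) (hdiff _ ⟨hcA, hout c⟩ _ ⟨hdA, hout d⟩)
  · intro y hy p hp h
    by_cases hpv : p ∈ seg a b k
    · exact Or.inl hpv
    · have hp2 := hside p ⟨hp, hpv⟩ y hy h
      have : p = (p.1, k + σ) := Prod.ext rfl hp2
      have hPp : P p.1 := ⟨this ▸ hp, y, hy, this ▸ h⟩
      exact Or.inr ⟨hp2, hcmin _ hPp, hdmax _ hPp⟩

/-- If the points of the bounded runs avoiding `r` are finite in number and every run separates
only such points from `r`, then a run can be removed from `A` up to homotopy equivalence. -/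
theorem exists_removable_run {i j : ℕ} (hij : (i = 1 ∧ j = 2) ∨ (i = 2 ∧ j = 1)) {A : Set Pt}
    {r : Pt} (hr : r ∈ A) (hconn : LinkConn i A) (hconn' : LinkConn j Aᶜ)
    (hfin : (runPoints A r).Finite)
    (hsep : ∀ a b k, IsRun A a b k → r ∉ seg a b k → separated i A r a b k ⊆ runPoints A r)
    {a₀ b₀ k₀ : ℤ} (hv₀ : IsRun A a₀ b₀ k₀) (hrv₀ : r ∉ seg a₀ b₀ k₀) :
    ∃ a b k, IsRun A a b k ∧ r ∉ seg a b k ∧ LinkConn i (A \ seg a b k) ∧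
      LinkConn j (A \ seg a b k)ᶜ ∧ HtpyEquiv i (subAdj i A) (subAdj i (A \ seg a b k)) := by
  have hi : i = 1 ∨ i = 2 := by omega
  have hj : j = 1 ∨ j = 2 := by omega
  obtain ⟨a, b, k, hv, hrv, h0⟩ :=
    exists_run_separated_eq_empty hi hr hconn hfin hsep _ a₀ b₀ k₀ hv₀ hrv₀ rfl
  have hdiff : LinkConn i (A \ seg a b k) := by
    refine LinkConn.of_root hi (r := r) fun p hp => ?_
    by_contra h
    have hps : p ∈ separated i A r a b k := ⟨hp, h⟩
    rwa [h0] at hps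
  refine ⟨a, b, k, hv, hrv, hdiff, ?_, hv.htpyEquiv_diff hij hr hrv hconn hconn' hdiff⟩
  refine LinkConn.of_root hj (r := (a - 1, k)) fun p hp => ?_
  by_cases hpA : p ∈ A
  · have hpv : p ∈ seg a b k := by
      by_contra h
      exact hp ⟨hpA, h⟩
    have hsub : seg (a - 1) b k ⊆ (A \ seg a b k)ᶜ := by
      rintro ⟨x, y⟩ hxy ⟨hA, hn⟩
      have h1 : ¬ (x = a - 1 ∧ y = k) := by rintro ⟨rfl, rfl⟩; exact hv.left hA
      simp only [mem_seg] at *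
      omega
    have := hv.le
    refine linked_seg hj hsub (mk_mem_seg.2 (by omega)) ?_
    rw [mem_seg] at hpv ⊢
    omega
  · exact (hconn' _ hv.left _ hpA).mono (Set.compl_subset_compl.2 Set.sdiff_subset)


/-! ### Bounded sets and the outside of a box -/

/-- The square `[-N,N] × [-N,N]`. -/
def box (N : ℤ) : Set Pt := {p | -N ≤ p.1 ∧ p.1 ≤ N ∧ -N ≤ p.2 ∧ p.2 ≤ N}

theorem mem_box {N : ℤ} {p : Pt} :
    p ∈ box N ↔ -N ≤ p.1 ∧ p.1 ≤ N ∧ -N ≤ p.2 ∧ p.2 ≤ N := Iff.rfl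

theorem finite_box (N : ℤ) : (box N).Finite :=
  (Set.finite_Icc ((-N, -N) : Pt) (N, N)).subset fun _ hp =>
    ⟨⟨hp.1, hp.2.2.1⟩, ⟨hp.2.1, hp.2.2.2⟩⟩

theorem exists_subset_box {X : Set Pt} (hX : X.Finite) : ∃ N, 0 ≤ N ∧ X ⊆ box N := by
  obtain ⟨M, hM⟩ := (hX.image fun p => |p.1| + |p.2|).bddAbove
  refine ⟨max M 0, le_max_right _ _, fun p hp => ?_⟩
  have h : |p.1| + |p.2| ≤ M := hM ⟨p, hp, rfl⟩
  have h1 := abs_nonneg p.1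
  have h2 := abs_nonneg p.2
  have h3 : |p.1| ≤ max M 0 := by omega
  have h4 : |p.2| ≤ max M 0 := by omega
  exact ⟨(abs_le.1 h3).1, (abs_le.1 h3).2, (abs_le.1 h4).1, (abs_le.1 h4).2⟩

theorem linked_of_notMem_box {j : ℕ} (hj : j = 1 ∨ j = 2) {X : Set Pt} {N : ℤ}
    (hX : X ⊆ box N) {p : Pt} (hp : p ∉ box N) : Linked j Xᶜ p (N + 1, N + 1) := by
  refine Linked.mono (Set.compl_subset_compl.2 hX) ?_
  obtain ⟨x, y⟩ := p
  rw [mem_box] at hp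
  dsimp only at hp
  by_cases hy : -N ≤ y ∧ y ≤ N
  · refine (linked_vertical (A := (box N)ᶜ) hj y (N + 1) x fun t h1 h2 h => ?_).trans
      (linked_horizontal hj x (N + 1) (N + 1) fun t h1 h2 h => ?_) <;>
    · rw [mem_box] at h
      dsimp only at h
      omega
  · refine (linked_horizontal (A := (box N)ᶜ) hj x (N + 1) y fun t h1 h2 h => ?_).trans
      (linked_vertical hj y (N + 1) (N + 1) fun t h1 h2 h => ?_) <;>
    · rw [mem_box] at h
      dsimp only at h
      omega

theorem NoHole.linkConn {j : ℕ} (hj : j = 1 ∨ j = 2) {X : Set Pt} (hX : X.Finite)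
    (h : NoHole j X) : LinkConn j Xᶜ := by
  obtain ⟨N, -, hN⟩ := exists_subset_box hX
  refine LinkConn.of_root hj (r := (N + 1, N + 1)) fun p hp => ?_
  obtain ⟨q, hq, hqN⟩ := (h p hp).exists_notMem_finite (finite_box N)
  exact Linked.symm hj ((ChainIn.linked hq).trans (linked_of_notMem_box hj hN hqN))

/-! ### Contractibility of connected digital pictures without holes -/

theorem exists_isRun_of_subset_box {X : Set Pt} {N : ℤ} (hX : X ⊆ box N) {z : Pt} (hz : z ∈ X) :
    ∃ a b, IsRun X a b z.2 ∧ z ∈ seg a b z.2 := by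
  have hzN := hX hz
  rw [mem_box] at hzN
  obtain ⟨a, b, hv, hzv, -⟩ := exists_isRun (x₁ := -N - 1) (x₂ := N + 1) hz (by omega) (by omega)
    (fun h => by have := hX h; rw [mem_box] at this; dsimp only at this; omega)
    (fun h => by have := hX h; rw [mem_box] at this; dsimp only at this; omega)
  exact ⟨a, b, hv, hzv⟩

theorem exists_ssubset_of_row_ne {i j : ℕ} (hij : (i = 1 ∧ j = 2) ∨ (i = 2 ∧ j = 1))
    {X : Set Pt} (hX : X.Finite) (hconn : LinkConn i X) (hconn' : LinkConn j Xᶜ) {r z : Pt}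
    (hr : r ∈ X) (hz : z ∈ X) (hzr : z.2 ≠ r.2) :
    ∃ Y ⊂ X, r ∈ Y ∧ LinkConn i Y ∧ LinkConn j Yᶜ ∧ HtpyEquiv i (subAdj i X) (subAdj i Y) := by
  have hi : i = 1 ∨ i = 2 := by omega
  obtain ⟨N, -, hN⟩ := exists_subset_box hX
  obtain ⟨a₀, b₀, hv₀, hzv₀⟩ := exists_isRun_of_subset_box hN hz
  have hsep : ∀ a b k, IsRun X a b k → r ∉ seg a b k → separated i X r a b k ⊆ runPoints X r := by
    rintro a b k hv hrv w ⟨hw, hnl⟩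
    obtain ⟨a', b', hv', hwv'⟩ := exists_isRun_of_subset_box hN hw.1
    refine ⟨a', b', w.2, hv', fun hrv' => hnl ?_, hwv'⟩
    have hsub : seg a' b' w.2 ⊆ X \ seg a b k := fun u hu => ⟨hv'.subset hu, fun hu' => by
      obtain ⟨rfl, rfl, rfl⟩ := hv.eq_of_mem hv' hu' hu
      exact hrv hrv'⟩
    exact linked_seg hi hsub hrv' hwv'
  obtain ⟨a, b, k, hv, hrv, h1, h2, h3⟩ := exists_removable_run hij hr hconn hconn'
    (hX.subset (by rintro w ⟨a, b, k, hv, -, hw⟩; exact hv.subset hw)) hsep hv₀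
    (fun h => hzr h.1.symm)
  refine ⟨X \ seg a b k, Set.ssubset_iff_exists.2 ⟨Set.sdiff_subset, (a, k), ?_, ?_⟩,
    ⟨hr, hrv⟩, h1, h2, h3⟩
  · exact hv.subset (mk_mem_seg.2 ⟨le_rfl, hv.le⟩)
  · exact fun h => h.2 (mk_mem_seg.2 ⟨le_rfl, hv.le⟩)

theorem htpyEquiv_unit {i j : ℕ} (hij : (i = 1 ∧ j = 2) ∨ (i = 2 ∧ j = 1)) (n : ℕ) :
    ∀ {r : Pt} {X : Set Pt}, X.Finite → X.ncard = n → LinkConn i X → LinkConn j Xᶜ → r ∈ X →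
      HtpyEquiv i (subAdj i X) (fun _ _ : Unit => True) := by
  have hi : i = 1 ∨ i = 2 := by omega
  have hj : j = 1 ∨ j = 2 := by omega
  induction n using Nat.strong_induction_on with
  | _ n ih =>
    rintro r X hX rfl hconn hconn' hr
    by_cases hrow : ∃ z ∈ X, z.2 ≠ r.2
    · obtain ⟨z, hz, hzr⟩ := hrow
      obtain ⟨Y, hYX, hrY, h1, h2, h3⟩ := exists_ssubset_of_row_ne hij hX hconn hconn' hr hz hzr
      exact h3.trans (ih _ (Set.ncard_lt_ncard hYX hX) (hX.subset hYX.subset) rfl h1 h2 hrY)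
    by_cases hcol : ∃ z ∈ X, z.1 ≠ r.1
    · obtain ⟨z, hz, hzr⟩ := hcol
      have hX' : (Prod.swap ⁻¹' X).Finite := hX.preimage Prod.swap_injective.injOn
      have hcard : (Prod.swap ⁻¹' X).ncard = X.ncard :=
        Set.ncard_preimage_of_injective_subset_range Prod.swap_injective
          (by rw [Prod.swap_surjective.range_eq]; exact Set.subset_univ _)
      obtain ⟨Y, hYX, hrY, h1, h2, h3⟩ := exists_ssubset_of_row_ne hij (X := Prod.swap ⁻¹' X)
        (r := r.swap) (z := z.swap) hX' (hconn.swap hi) (hconn'.swap hj) (by simpa using hr)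
        (by simpa using hz) hzr
      exact ((htpyEquiv_swap hi X).trans h3).trans
        (ih _ (hcard ▸ Set.ncard_lt_ncard hYX hX') (hX'.subset hYX.subset) rfl h1 h2 hrY)
    · push Not at hrow hcol
      obtain rfl : X = {r} := Set.eq_singleton_iff_unique_mem.2
        ⟨hr, fun z hz => Prod.ext (hcol z hz) (hrow z hz)⟩
      exact htpyEquiv_singleton hi r

/-! ### Filling gaps between points of a row -/

theorem exists_filled_of_not_rowConvex {i j : ℕ} (hij : (i = 1 ∧ j = 2) ∨ (i = 2 ∧ j = 1))
    {X : Set Pt} (hX : X.Finite) (hconn : LinkConn i X) (hconn' : LinkConn j Xᶜ)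
    (hrc : ¬ RowConvex X) :
    ∃ Y, X ⊂ Y ∧ (∀ S, RowConvex S → X ⊆ S → Y ⊆ S) ∧ LinkConn i Y ∧ LinkConn j Yᶜ ∧
      HtpyEquiv j (subAdj j Xᶜ) (subAdj j Yᶜ) := by
  have hj : j = 1 ∨ j = 2 := by omega
  obtain ⟨N, hN0, hN⟩ := exists_subset_box hX
  have hfill : ∀ {a b k : ℤ}, IsRun Xᶜ a b k → ∀ S, RowConvex S → X ⊆ S → seg a b k ⊆ S := by
    rintro a b k hv S hS hXS ⟨x, y⟩ ⟨hy, hax, hxb⟩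
    dsimp only at hy hax hxb
    subst hy
    exact hS (a - 1) x (b + 1) y (hXS (not_not.1 hv.left)) (hXS (not_not.1 hv.right)) (by omega)
      (by omega)
  have hbox : RowConvex (box N) := by
    intro a b c k ha hc h1 h2
    rw [mem_box] at *
    dsimp only at *
    omega
  set r : Pt := (N + 1, N + 1) with hr
  have hrN : r ∉ box N := fun h => by
    rw [hr, mem_box] at h
    dsimp only at h
    omega
  have hrX : r ∈ Xᶜ := fun h => hrN (hN h)
  have hrun : ∀ {a b k}, IsRun Xᶜ a b k → r ∉ seg a b k := fun hv h =>
    hrN (hfill hv _ hbox hN h)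
  have hfin : (runPoints Xᶜ r).Finite := by
    refine (finite_box N).subset ?_
    rintro w ⟨a, b, k, hv, -, hw⟩
    exact hfill hv _ hbox hN hw
  have hsep : ∀ a b k, IsRun Xᶜ a b k → r ∉ seg a b k →
      separated j Xᶜ r a b k ⊆ runPoints Xᶜ r := by
    rintro a b k hv - ⟨x, y⟩ ⟨⟨hw, hwv⟩, hnl⟩
    have hset : Xᶜ \ seg a b k = (X ∪ seg a b k)ᶜ := by
      rw [Set.compl_union, Set.sdiff_eq]
    have hsub : X ∪ seg a b k ⊆ box N := Set.union_subset hN (hfill hv _ hbox hN)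
    rw [hset] at hnl
    have hray : ∀ x', (x', y) ∉ box N → ¬ ∀ t, min x x' ≤ t → t ≤ max x x' → (t, y) ∉ X := by
      intro x' hx' h
      refine hnl (Linked.symm hj (Relation.ReflTransGen.trans
        (linked_horizontal (A := (X ∪ seg a b k)ᶜ) hj x x' y fun t h1 h2 ht => ?_)
        (linked_of_notMem_box hj hsub hx')))
      rcases ht with ht | ⟨hk, ha, hb⟩
      · exact h t h1 h2 ht
      · dsimp only at hk ha hb
        subst hk
        have hl : ¬ (min x x' ≤ a - 1 ∧ a - 1 ≤ max x x') := fun hh =>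
          h (a - 1) hh.1 hh.2 (not_not.1 hv.left)
        have hrr : ¬ (min x x' ≤ b + 1 ∧ b + 1 ≤ max x x') := fun hh =>
          h (b + 1) hh.1 hh.2 (not_not.1 hv.right)
        have hxv : ¬ (a ≤ x ∧ x ≤ b) := fun hh => hwv (mk_mem_seg.2 hh)
        have hxv' : ¬ (a ≤ x' ∧ x' ≤ b) := fun hh => hx' (hsub (Or.inr (mk_mem_seg.2 hh)))
        omega
    by_cases hy : -N ≤ y ∧ y ≤ N
    · have hl := hray (min x (-N - 1)) (by rw [mem_box]; dsimp only; omega)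
      have hrr := hray (max x (N + 1)) (by rw [mem_box]; dsimp only; omega)
      push Not at hl hrr
      obtain ⟨t, ht1, ht2, ht⟩ := hl
      obtain ⟨t', ht1', ht2', ht'⟩ := hrr
      have h6 : t ≠ x := by rintro rfl; exact hw ht
      have h7 : t' ≠ x := by rintro rfl; exact hw ht'
      obtain ⟨a', b', hv', hwv', -⟩ := exists_isRun (A := Xᶜ) (z := (x, y)) (x₁ := t) (x₂ := t') hw
        (by dsimp only; omega) (by dsimp only; omega) (not_not.2 ht) (not_not.2 ht')
      exact ⟨a', b', y, hv', hrun hv', hwv'⟩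
    · refine absurd ?_ (hray x (by rw [mem_box]; dsimp only; omega))
      intro t h1 h2 ht
      obtain rfl : t = x := by omega
      exact hw ht
  rw [RowConvex] at hrc
  push Not at hrc
  obtain ⟨x₁, x, x₂, y, hx₁, hx₂, h1, h2, hx⟩ := hrc
  have hx₁' : x₁ ≠ x := by rintro rfl; exact hx hx₁
  have hx₂' : x ≠ x₂ := by rintro rfl; exact hx hx₂
  obtain ⟨a₀, b₀, hv₀, -⟩ := exists_isRun (A := Xᶜ) (z := (x, y)) (x₁ := x₁) (x₂ := x₂) hx
    (by dsimp only; omega) (by dsimp only; omega) (not_not.2 hx₁) (not_not.2 hx₂)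
  obtain ⟨a, b, k, hv, -, h3, h4, h5⟩ := exists_removable_run (A := Xᶜ) (i := j) (j := i)
    (by omega) hrX hconn' (by rwa [compl_compl]) hfin hsep hv₀ (hrun hv₀)
  have hset : Xᶜ \ seg a b k = (X ∪ seg a b k)ᶜ := by
    rw [Set.compl_union, Set.sdiff_eq]
  rw [hset] at h3 h4 h5
  rw [compl_compl] at h4
  have hak : (a, k) ∈ seg a b k := mk_mem_seg.2 ⟨le_rfl, hv.le⟩
  exact ⟨X ∪ seg a b k, Set.ssubset_iff_exists.2
    ⟨Set.subset_union_left, (a, k), Or.inr hak, hv.subset hak⟩,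
    fun S hS hXS => Set.union_subset hXS (hfill hv S hS hXS), h4, h3, h5⟩

/-! ### The rc-convex hull -/

theorem subset_Hrc (X : Set Pt) : X ⊆ Hrc X := Set.subset_sInter fun _ hS => hS.2

theorem Hrc_subset {X S : Set Pt} (hr : RowConvex S) (hc : ColConvex S) (hXS : X ⊆ S) :
    Hrc X ⊆ S := Set.sInter_subset_of_mem ⟨⟨hr, hc⟩, hXS⟩

theorem rowConvex_Hrc (X : Set Pt) : RowConvex (Hrc X) := fun a b c k ha hc h1 h2 S hS =>
  hS.1.1 a b c k (ha S hS) (hc S hS) h1 h2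

theorem colConvex_Hrc (X : Set Pt) : ColConvex (Hrc X) := fun a b c k ha hc h1 h2 S hS =>
  hS.1.2 a b c k (ha S hS) (hc S hS) h1 h2

theorem Hrc_eq_of_subset {X Y : Set Pt} (hXY : X ⊆ Y) (hY : Y ⊆ Hrc X) : Hrc Y = Hrc X :=
  (Hrc_subset (rowConvex_Hrc X) (colConvex_Hrc X) hY).antisymm
    (Hrc_subset (rowConvex_Hrc Y) (colConvex_Hrc Y) (hXY.trans (subset_Hrc Y)))

theorem Hrc_finite {X : Set Pt} (hX : X.Finite) : (Hrc X).Finite := by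
  obtain ⟨N, -, hN⟩ := exists_subset_box hX
  refine (finite_box N).subset (Hrc_subset ?_ ?_ hN) <;>
  · intro a b c k ha hc h1 h2
    rw [mem_box] at *
    dsimp only at *
    omega

theorem htpyEquiv_compl_Hrc {i j : ℕ} (hij : (i = 1 ∧ j = 2) ∨ (i = 2 ∧ j = 1)) (n : ℕ) :
    ∀ {X : Set Pt}, X.Finite → (Hrc X \ X).ncard = n → LinkConn i X → LinkConn j Xᶜ →
      HtpyEquiv j (subAdj j Xᶜ) (subAdj j (Hrc X)ᶜ) ∧ LinkConn i (Hrc X) ∧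
        LinkConn j (Hrc X)ᶜ := by
  have hi : i = 1 ∨ i = 2 := by omega
  have hj : j = 1 ∨ j = 2 := by omega
  induction n using Nat.strong_induction_on with
  | _ n ih =>
    rintro X hX rfl hconn hconn'
    have step : ∀ Y, X ⊂ Y → Y ⊆ Hrc X → LinkConn i Y → LinkConn j Yᶜ →
        HtpyEquiv j (subAdj j Xᶜ) (subAdj j Yᶜ) →
        HtpyEquiv j (subAdj j Xᶜ) (subAdj j (Hrc X)ᶜ) ∧ LinkConn i (Hrc X) ∧
          LinkConn j (Hrc X)ᶜ := by
      intro Y hXY hY h1 h2 h3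
      have hH := Hrc_eq_of_subset hXY.subset hY
      obtain ⟨z, hzY, hzX⟩ := (Set.ssubset_iff_exists.1 hXY).2
      have hlt : (Hrc Y \ Y).ncard < (Hrc X \ X).ncard := by
        rw [hH]
        exact Set.ncard_lt_ncard (Set.ssubset_iff_exists.2
          ⟨Set.sdiff_subset_sdiff_right hXY.subset, z, ⟨hY hzY, hzX⟩, fun h => h.2 hzY⟩)
          ((Hrc_finite hX).subset Set.sdiff_subset)
      have := ih _ hlt ((Hrc_finite hX).subset hY) rfl h1 h2
      rw [hH] at this
      exact ⟨h3.trans this.1, this.2⟩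
    by_cases hrow : RowConvex X
    · by_cases hcol : ColConvex X
      · have hH : Hrc X = X := (Hrc_subset hrow hcol subset_rfl).antisymm (subset_Hrc X)
        rw [hH]
        exact ⟨htpyEquiv_refl hj _, hconn, hconn'⟩
      · obtain ⟨Y, hXY, hYS, h1, h2, h3⟩ := exists_filled_of_not_rowConvex hij
          (X := Prod.swap ⁻¹' X) (hX.preimage Prod.swap_injective.injOn) (hconn.swap hi)
          (hconn'.swap hj) hcol
        obtain ⟨z, hzY, hzX⟩ := (Set.ssubset_iff_exists.1 hXY).2
        refine step (Prod.swap ⁻¹' Y) (Set.ssubset_iff_exists.2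
          ⟨fun p hp => hXY.subset (by simpa using hp), z.swap, by simpa using hzY, hzX⟩) ?_
          (h1.swap hi) (h2.swap hj)
          (((htpyEquiv_swap hj Xᶜ).trans h3).trans (htpyEquiv_swap hj Yᶜ))
        intro p hp
        have := hYS (Prod.swap ⁻¹' Hrc X) (colConvex_Hrc X) (fun q hq => subset_Hrc X hq) hp
        simpa using this
    · obtain ⟨Y, hXY, hYS, h1, h2, h3⟩ := exists_filled_of_not_rowConvex hij hX hconn hconn' hrow
      exact step Y hXY (hYS _ (rowConvex_Hrc X) (subset_Hrc X)) h1 h2 h3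

/-- a nonempty `c_i`-connected digital picture with no hole is
homotopy equivalent to its rc-convex hull. -/
theorem stmt16 (i j : ℕ) (hij : (i = 1 ∧ j = 2) ∨ (i = 2 ∧ j = 1))
    (X : Set Pt) (hX : X.Finite) (hne : X.Nonempty)
    (hconn : Conn i X) (hnohole : NoHole j X) :
    PicHtpyEquiv i j X (Hrc X) := by
  have hj : j = 1 ∨ j = 2 := by omega
  obtain ⟨r, hr⟩ := hne
  have hX₁ : LinkConn i X := fun p hp q hq => (hconn p hp q hq).linked
  have hX₂ := hnohole.linkConn hj hX
  obtain ⟨h, hH₁, hH₂⟩ := htpyEquiv_compl_Hrc hij _ hX rfl hX₁ hX₂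
  exact ⟨(htpyEquiv_unit hij _ hX rfl hX₁ hX₂ hr).trans
    (htpyEquiv_unit hij _ (Hrc_finite hX) rfl hH₁ hH₂ (subset_Hrc X hr)).symm, h⟩
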